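/- Shearing versus bending, second part: let φ : 𝕊² → ℝ³ be a smooth immersion, ν a unit normal field for φ, and η an isogauss infinitesimal deformation of φ with respect to ν. Then (since H¹(𝕊²) = 0) there exists a smooth map ξ : 𝕊² → ℝ³ with dξ_x X = η x × dφ_x X for every x ∈ 𝕊² and every X ∈ T_x𝕊²; any such ξ is an isometric infinitesimal deformation of φ with rotation vector field η. -/

import Mathlib

noncomputable section

open scoped Manifold RealInnerProductSpace
open Metric Module

local notation "ℝ³" => EuclideanSpace ℝ (Fin 3)

instance : Fact (finrank ℝ ℝ³ = 2 + 1) := ⟨by simp⟩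

local notation "𝕊²" => sphere (0 : ℝ³) 1

/-- The cross product on `ℝ³ = EuclideanSpace ℝ (Fin 3)`. -/
def cross (a b : ℝ³) : ℝ³ :=
  (EuclideanSpace.equiv (Fin 3) ℝ).symm
    (crossProduct (EuclideanSpace.equiv (Fin 3) ℝ a) (EuclideanSpace.equiv (Fin 3) ℝ b))

/-- `f : 𝕊² → ℝ³` is smooth (`C^∞`). -/
def Smooth3 (f : 𝕊² → ℝ³) : Prop := ContMDiff (𝓡 2) 𝓘(ℝ, ℝ³) (⊤ : ℕ∞) f

/-- The manifold derivative of `f : 𝕊² → ℝ³` at `x ∈ 𝕊²`. -/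
def mfd (f : 𝕊² → ℝ³) (x : 𝕊²) : TangentSpace (𝓡 2) x →L[ℝ] ℝ³ :=
  mfderiv (𝓡 2) 𝓘(ℝ, ℝ³) f x

/-- `ν` is a unit normal field for `φ`. -/
def IsUnitNormalField (φ ν : 𝕊² → ℝ³) : Prop :=
  Smooth3 ν ∧ (∀ x, ‖ν x‖ = 1) ∧
    ∀ (x : 𝕊²) (X : TangentSpace (𝓡 2) x), ⟪ν x, mfd φ x X⟫ = 0

/-- `φ` has everywhere positive Gauss curvature with respect to `ν`. -/
def PosGaussCurvature (φ ν : 𝕊² → ℝ³) : Prop :=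
  ∀ (x : 𝕊²) (X Y : TangentSpace (𝓡 2) x), LinearIndependent ℝ ![X, Y] →
    0 < ⟪cross (mfd ν x X) (mfd ν x Y), cross (mfd φ x X) (mfd φ x Y)⟫

/-- `η` is an isogauss infinitesimal deformation of `φ` with respect to `ν`. -/
def IsIsogaussDeformation (φ ν η : 𝕊² → ℝ³) : Prop :=
  Smooth3 η ∧
    (∀ (x : 𝕊²) (X : TangentSpace (𝓡 2) x), ⟪mfd η x X, ν x⟫ = 0) ∧
    ∀ (x : 𝕊²) (X Y : TangentSpace (𝓡 2) x),
      cross (mfd η x X) (mfd φ x Y) + cross (mfd φ x X) (mfd η x Y) = 0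

/-- `ξ` is an isometric infinitesimal deformation of `φ`. -/
def IsIsometricDeformation (φ ξ : 𝕊² → ℝ³) : Prop :=
  Smooth3 ξ ∧
    ∀ (x : 𝕊²) (X Y : TangentSpace (𝓡 2) x),
      ⟪mfd ξ x X, mfd φ x Y⟫ + ⟪mfd φ x X, mfd ξ x Y⟫ = 0

/-- `η` is the rotation vector field of the isometric infinitesimal deformation `ξ` of `φ`. -/
def IsRotationField (φ ξ η : 𝕊² → ℝ³) : Prop :=
  Smooth3 η ∧
    ∀ (x : 𝕊²) (X : TangentSpace (𝓡 2) x), mfd ξ x X = cross (η x) (mfd φ x X)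

/-- The cross product on `ℝ³` as a continuous bilinear map. -/
def crossL : ℝ³ →L[ℝ] ℝ³ →L[ℝ] ℝ³ :=
  LinearMap.toContinuousLinearMap
    ((LinearMap.toContinuousLinearMap :
        (ℝ³ →ₗ[ℝ] ℝ³) ≃ₗ[ℝ] (ℝ³ →L[ℝ] ℝ³)).toLinearMap ∘ₗ
      LinearMap.mk₂ ℝ cross
        (by intros; simp [cross]) (by intros; simp [cross])
        (by intros; simp [cross]) (by intros; simp [cross]))

theorem crossL_apply (a b : ℝ³) : crossL a b = cross a b := rfl

theorem cross_eq_neg_cross (a b : ℝ³) : cross a b = -cross b a := by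
  rw [cross, cross, ← cross_anticomm, map_neg]

theorem inner_cross_add_inner_cross (c a b : ℝ³) : ⟪cross c a, b⟫ + ⟪a, cross c b⟫ = 0 := by
  simp [cross, PiLp.inner_apply, Fin.sum_univ_three, cross_apply]
  ring

theorem contMDiffOn_stereographic' (u : 𝕊²) :
    ContMDiffOn (𝓡 2) (𝓡 2) (⊤ : ℕ∞) (stereographic' 2 u) {u}ᶜ := by
  have h := contMDiffOn_of_mem_maximalAtlas (I := 𝓡 2) (n := ((⊤ : ℕ∞) : WithTop ℕ∞))
    (IsManifold.subset_maximalAtlas (I := 𝓡 2) (n := ((⊤ : ℕ∞) : WithTop ℕ∞))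
      (show stereographic' 2 u ∈ atlas (EuclideanSpace ℝ (Fin 2)) 𝕊² from ⟨u, rfl⟩))
  rwa [stereographic'_source] at h

theorem contMDiff_stereographic'_symm (u : 𝕊²) :
    ContMDiff (𝓡 2) (𝓡 2) (⊤ : ℕ∞) (stereographic' 2 u).symm := by
  have h := contMDiffOn_symm_of_mem_maximalAtlas (I := 𝓡 2) (n := ((⊤ : ℕ∞) : WithTop ℕ∞))
    (IsManifold.subset_maximalAtlas (I := 𝓡 2) (n := ((⊤ : ℕ∞) : WithTop ℕ∞))
      (show stereographic' 2 u ∈ atlas (EuclideanSpace ℝ (Fin 2)) 𝕊² from ⟨u, rfl⟩))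
  rwa [stereographic'_target, contMDiffOn_univ] at h

/-- The chain rule for the inverse of a stereographic chart. -/
theorem fderiv_comp_stereographic'_symm {f : 𝕊² → ℝ³} {u : 𝕊²} {y : EuclideanSpace ℝ (Fin 2)}
    (hf : MDifferentiableAt (𝓡 2) 𝓘(ℝ, ℝ³) f ((stereographic' 2 u).symm y))
    (w : EuclideanSpace ℝ (Fin 2)) :
    fderiv ℝ (f ∘ (stereographic' 2 u).symm) y w =
      mfd f ((stereographic' 2 u).symm y)
        (mfderiv (𝓡 2) (𝓡 2) (stereographic' 2 u).symm y w) := by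
  have hg : MDifferentiableAt (𝓡 2) (𝓡 2) (stereographic' 2 u).symm y :=
    (contMDiff_stereographic'_symm u).mdifferentiableAt (by simp)
  rw [← mfderiv_eq_fderiv, mfderiv_comp y hf hg]
  rfl

/-- Away from a point `u`, a closed form `η × dφ` on `𝕊²` has a primitive. -/
theorem exists_primitive_compl_singleton {φ η : 𝕊² → ℝ³} (hφ : Smooth3 φ) (hη : Smooth3 η)
    (hc : ∀ (x : 𝕊²) (X Y : TangentSpace (𝓡 2) x),
      cross (mfd η x X) (mfd φ x Y) + cross (mfd φ x X) (mfd η x Y) = 0) (u : 𝕊²) :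
    ∃ F : 𝕊² → ℝ³, ContMDiffOn (𝓡 2) 𝓘(ℝ, ℝ³) (⊤ : ℕ∞) F {u}ᶜ ∧
      ∀ x ∈ ({u}ᶜ : Set 𝕊²), ∀ X : TangentSpace (𝓡 2) x,
        mfd F x X = cross (η x) (mfd φ x X) := by
  set c := stereographic' 2 u with hcdef
  have hg : ContMDiff (𝓡 2) (𝓡 2) (⊤ : ℕ∞) c.symm := contMDiff_stereographic'_symm u
  have ha : ContDiff ℝ (⊤ : ℕ∞) (φ ∘ c.symm) := (hφ.comp hg).contDiff
  have hh : ContDiff ℝ (⊤ : ℕ∞) (η ∘ c.symm) := (hη.comp hg).contDiff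
  have hda : ContDiff ℝ (⊤ : ℕ∞) (fderiv ℝ (φ ∘ c.symm)) := ha.fderiv_right (by simp)
  have hch : ContDiff ℝ (⊤ : ℕ∞) (fun y ↦ crossL ((η ∘ c.symm) y)) :=
    crossL.contDiff.comp hh
  have hW : ContDiff ℝ (⊤ : ℕ∞)
      (fun y ↦ (crossL ((η ∘ c.symm) y)).comp (fderiv ℝ (φ ∘ c.symm) y)) :=
    hch.clm_comp hda
  have hφd (x) : MDifferentiableAt (𝓡 2) 𝓘(ℝ, ℝ³) φ x := hφ.mdifferentiableAt (by simp)
  have hηd (x) : MDifferentiableAt (𝓡 2) 𝓘(ℝ, ℝ³) η x := hη.mdifferentiableAt (by simp)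
  obtain ⟨f, hf⟩ := convex_univ.exists_forall_hasFDerivAt_of_fderiv_symmetric isOpen_univ
    (hW.differentiable (by simp)).differentiableOn (by
      intro y _ v w
      have h1 : HasFDerivAt (fun y ↦ crossL ((η ∘ c.symm) y))
          (crossL.comp (fderiv ℝ (η ∘ c.symm) y)) y :=
        crossL.hasFDerivAt.comp y (hh.differentiable (by simp) y).hasFDerivAt
      have h2 := (hda.differentiable (by simp) y).hasFDerivAt
      rw [(h1.clm_comp h2).fderiv]
      have hs := (ha.contDiffAt (x := y)).isSymmSndFDerivAt (by
        rw [minSmoothness_of_isRCLikeNormedField]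
        exact WithTop.coe_le_coe.2 (le_top : (2 : ℕ∞) ≤ ⊤)) v w
      have hcl := hc (c.symm y) (mfderiv (𝓡 2) (𝓡 2) c.symm y v)
        (mfderiv (𝓡 2) (𝓡 2) c.symm y w)
      rw [← fderiv_comp_stereographic'_symm (hφd _), ← fderiv_comp_stereographic'_symm (hηd _),
        ← fderiv_comp_stereographic'_symm (hφd _), ← fderiv_comp_stereographic'_symm (hηd _),
        cross_eq_neg_cross (fderiv ℝ (φ ∘ _) y v), ← sub_eq_add_neg, sub_eq_zero, ← hcdef] at hcl
      simp only [add_apply, ContinuousLinearMap.comp_apply,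
        ContinuousLinearMap.compL_apply, ContinuousLinearMap.flip_apply, crossL_apply, hs]
      rw [hcl])
  have hfs : ContDiff ℝ (⊤ : ℕ∞) f := by
    rw [contDiff_infty_iff_fderiv]
    refine ⟨fun y ↦ (hf y trivial).differentiableAt, ?_⟩
    rwa [funext fun y ↦ (hf y trivial).fderiv]
  have hcs := contMDiffOn_stereographic' u
  refine ⟨f ∘ c, hfs.contMDiff.comp_contMDiffOn hcs, fun x hx X ↦ ?_⟩
  have hxs : x ∈ c.source := by rwa [hcdef, stereographic'_source]
  have hcx : MDifferentiableAt (𝓡 2) (𝓡 2) c x :=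
    (hcs.contMDiffAt (isOpen_compl_singleton.mem_nhds hx)).mdifferentiableAt (by simp)
  obtain ⟨w, hcomp⟩ : ∃ w, ∀ k : EuclideanSpace ℝ (Fin 2) → ℝ³, DifferentiableAt ℝ k (c x) →
      mfd (k ∘ c) x X = fderiv ℝ k (c x) w := by
    refine ⟨mfderiv (𝓡 2) (𝓡 2) c x X, fun k hk ↦ ?_⟩
    rw [mfd, mfderiv_comp x hk.mdifferentiableAt hcx, ← mfderiv_eq_fderiv]
    rfl
  have hφc : mfd ((φ ∘ c.symm) ∘ c) x = mfd φ x := by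
    refine Filter.EventuallyEq.mfderiv_eq ?_
    filter_upwards [c.open_source.mem_nhds hxs] with z hz
    simp [c.left_inv hz]
  rw [hcomp _ (hf _ trivial).differentiableAt, (hf _ trivial).fderiv, ContinuousLinearMap.comp_apply,
    ← hcomp _ (ha.differentiable (by simp) _), hφc, crossL_apply, Function.comp_apply,
    c.left_inv hxs]

/-- A map with vanishing derivative away from two antipodal points is constant there. -/
theorem exists_eq_const_of_mfd_eq_zero {D : 𝕊² → ℝ³} (u : 𝕊²)
    (hD : ∀ x ∈ ({u, -u}ᶜ : Set 𝕊²), MDifferentiableAt (𝓡 2) 𝓘(ℝ, ℝ³) D x ∧ mfd D x = 0) :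
    ∃ k, ∀ x ∈ ({u, -u}ᶜ : Set 𝕊²), D x = k := by
  set c := stereographic' 2 u with hcdef
  have hc0 : c (-u) = 0 := by simp [hcdef, stereographic']
  have hmem : ∀ y ∈ ({0}ᶜ : Set (EuclideanSpace ℝ (Fin 2))),
      c.symm y ∈ ({u, -u}ᶜ : Set 𝕊²) := by
    intro y hy
    have hyt : y ∈ c.target := by simp [hcdef]
    have h1 : c.symm y ∈ c.source := c.map_target hyt
    rw [hcdef, stereographic'_source] at h1
    rintro (h | h)
    · exact h1 h
    · refine hy ?_
      rw [Set.mem_singleton_iff, ← c.right_inv hyt, h, hc0]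
  have hconn : IsPreconnected ({0}ᶜ : Set (EuclideanSpace ℝ (Fin 2))) :=
    (isConnected_compl_singleton_of_one_lt_rank (by
      rw [← Module.finrank_eq_rank]; simp) 0).isPreconnected
  obtain ⟨k, hk⟩ := isOpen_compl_singleton.exists_is_const_of_fderiv_eq_zero (𝕜 := ℝ)
    (f := D ∘ c.symm) hconn
    (fun y hy ↦ by
      have := (hD _ (hmem y hy)).1.comp y
        ((contMDiff_stereographic'_symm u).mdifferentiableAt (by simp))
      exact this.differentiableAt.differentiableWithinAt)
    (fun y hy ↦ by
      ext1 w
      rw [fderiv_comp_stereographic'_symm (hD _ (hmem y hy)).1, (hD _ (hmem y hy)).2]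
      rfl)
  refine ⟨k, fun x hx ↦ ?_⟩
  simp only [Set.mem_compl_iff, Set.mem_insert_iff, Set.mem_singleton_iff, not_or] at hx
  have hxs : x ∈ c.source := by simpa [hcdef] using hx.1
  have hx0 : c x ∈ ({0}ᶜ : Set (EuclideanSpace ℝ (Fin 2))) := by
    intro h
    refine hx.2 (c.injOn hxs ?_ (h.trans hc0.symm))
    simpa [hcdef] using (ne_neg_of_mem_unit_sphere ℝ u).symm
  simpa [c.left_inv hxs] using hk _ hx0

/-- A closed form `η × dφ` on `𝕊²` has a primitive. -/
theorem exists_primitive {φ η : 𝕊² → ℝ³} (hφ : Smooth3 φ) (hη : Smooth3 η)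
    (hc : ∀ (x : 𝕊²) (X Y : TangentSpace (𝓡 2) x),
      cross (mfd η x X) (mfd φ x Y) + cross (mfd φ x X) (mfd η x Y) = 0) :
    ∃ ξ : 𝕊² → ℝ³, Smooth3 ξ ∧
      ∀ (x : 𝕊²) (X : TangentSpace (𝓡 2) x), mfd ξ x X = cross (η x) (mfd φ x X) := by
  classical
  obtain ⟨u⟩ : Nonempty 𝕊² := (NormedSpace.sphere_nonempty.mpr zero_le_one).to_subtype
  have hu : u ≠ -u := ne_neg_of_mem_unit_sphere ℝ u
  obtain ⟨F, hF, hF'⟩ := exists_primitive_compl_singleton hφ hη hc u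
  obtain ⟨G, hG, hG'⟩ := exists_primitive_compl_singleton hφ hη hc (-u)
  have hFx {x : 𝕊²} (hx : x ≠ u) : ContMDiffAt (𝓡 2) 𝓘(ℝ, ℝ³) (⊤ : ℕ∞) F x :=
    hF.contMDiffAt (isOpen_compl_singleton.mem_nhds hx)
  have hGx {x : 𝕊²} (hx : x ≠ -u) : ContMDiffAt (𝓡 2) 𝓘(ℝ, ℝ³) (⊤ : ℕ∞) G x :=
    hG.contMDiffAt (isOpen_compl_singleton.mem_nhds hx)
  obtain ⟨k, hk⟩ := exists_eq_const_of_mfd_eq_zero (D := F - G) u (by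
    intro x hx
    simp only [Set.mem_compl_iff, Set.mem_insert_iff, Set.mem_singleton_iff, not_or] at hx
    have h1 := (hFx hx.1).mdifferentiableAt (by simp)
    have h2 := (hGx hx.2).mdifferentiableAt (by simp)
    refine ⟨h1.sub h2, ?_⟩
    ext1 X
    have h3 : mfd (F - G) x = mfd F x - mfd G x := mfderiv_sub h1 h2
    rw [h3, sub_apply, hF' x hx.1, hG' x hx.2, sub_self]
    rfl)
  let ξ : 𝕊² → ℝ³ := fun x ↦ if x = u then G x + k else F x
  have key : ∀ x, ContMDiffAt (𝓡 2) 𝓘(ℝ, ℝ³) (⊤ : ℕ∞) ξ x ∧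
      ∀ X : TangentSpace (𝓡 2) x, mfd ξ x X = cross (η x) (mfd φ x X) := by
    intro x
    rcases eq_or_ne x u with rfl | hx
    · have heq : ξ =ᶠ[nhds x] G + fun _ ↦ k := by
        filter_upwards [isOpen_compl_singleton.mem_nhds hu] with z hz
        by_cases hzx : z = x
        · simp [ξ, hzx]
        · have := hk z (by simpa [hzx] using hz)
          simp [ξ, hzx, ← this]
      refine ⟨((hGx hu).add contMDiffAt_const).congr_of_eventuallyEq heq, fun X ↦ ?_⟩
      have h1 : mfd ξ x = mfd (G + fun _ ↦ k) x := heq.mfderiv_eq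
      have h2 : mfd (G + fun _ ↦ k) x = mfd G x + mfd (fun _ ↦ k) x :=
        mfderiv_add ((hGx hu).mdifferentiableAt (by simp)) mdifferentiableAt_const
      have h3 : mfd (fun _ ↦ k) x = 0 := mfderiv_const
      rw [h1, h2, h3, add_zero, hG' x hu]
    · have heq : ξ =ᶠ[nhds x] F := by
        filter_upwards [isOpen_compl_singleton.mem_nhds hx] with z hz
        simp [ξ, show z ≠ u from hz]
      refine ⟨(hFx hx).congr_of_eventuallyEq heq, fun X ↦ ?_⟩
      have h1 : mfd ξ x = mfd F x := heq.mfderiv_eq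
      rw [h1, hF' x hx]
  exact ⟨ξ, fun x ↦ (key x).1, fun x ↦ (key x).2⟩

/-- **Shearing vs. bending, second part**: an isogauss infinitesimal deformation `η` is
the rotation vector field of some isometric infinitesimal deformation `ξ`, and any such
`ξ` is an isometric infinitesimal deformation with rotation vector field `η`. -/
theorem isogauss_is_rotation_field_of_isometric (φ ν η : 𝕊² → ℝ³)
    (hφ : Smooth3 φ) (hφimm : ∀ x : 𝕊², Function.Injective (mfd φ x))
    (hν : IsUnitNormalField φ ν)
    (hη : IsIsogaussDeformation φ ν η) :
    (∃ ξ : 𝕊² → ℝ³, Smooth3 ξ ∧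
        ∀ (x : 𝕊²) (X : TangentSpace (𝓡 2) x), mfd ξ x X = cross (η x) (mfd φ x X)) ∧
      ∀ ξ : 𝕊² → ℝ³, Smooth3 ξ →
        (∀ (x : 𝕊²) (X : TangentSpace (𝓡 2) x), mfd ξ x X = cross (η x) (mfd φ x X)) →
        IsIsometricDeformation φ ξ ∧ IsRotationField φ ξ η := by
  refine ⟨exists_primitive hφ hη.1 hη.2.2, fun ξ hξ hrot ↦ ⟨⟨hξ, fun x X Y ↦ ?_⟩, hη.1, hrot⟩⟩
  rw [hrot, hrot]
  exact inner_cross_add_inner_cross _ _ _
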